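/- ∂Σ is the minimal nonempty closed invariant subset of Σ: ∂Σ is nonempty, closed and invariant, and every nonempty closed invariant subset of Σ contains ∂Σ. -/

import Mathlib

variable {G : Type*} [Group G]

/-- Left translate `g·X = {gx : x ∈ X}`. -/
def lmul (g : G) (X : Set G) : Set G := (g * ·) '' X

/-- `p⁻¹X = {y ∈ P : py ∈ X}`. -/
def presub (P : Submonoid G) (p : G) (X : Set G) : Set G := {y : G | y ∈ P ∧ p * y ∈ X}

/-- The constructible right ideals of `P`: the smallest family of subsets of `P`
containing `∅` and `P` and closed under `X ↦ pX` and `X ↦ p⁻¹X` for `p ∈ P`. -/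
inductive IsConstructible (P : Submonoid G) : Set G → Prop
  | empty : IsConstructible P ∅
  | base : IsConstructible P (P : Set G)
  | mul {p : G} (hp : p ∈ P) {X : Set G} (hX : IsConstructible P X) : IsConstructible P (lmul p X)
  | pre {p : G} (hp : p ∈ P) {X : Set G} (hX : IsConstructible P X) :
      IsConstructible P (presub P p X)

/-- `𝒥_P^G`: the smallest family of subsets of `G` containing `𝒥`, closed under left
translations by group elements and under finite intersections. -/
inductive IsConstructibleG (P : Submonoid G) : Set G → Prop
  | base {X : Set G} (hX : IsConstructible P X) : IsConstructibleG P X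
  | translate (g : G) {Y : Set G} (hY : IsConstructibleG P Y) : IsConstructibleG P (lmul g Y)
  | inter {Y₁ Y₂ : Set G} (h1 : IsConstructibleG P Y₁) (h2 : IsConstructibleG P Y₂) :
      IsConstructibleG P (Y₁ ∩ Y₂)

/-- A family of subsets (containing `∅` and closed under finite intersections) is
independent if whenever a member equals a finite union of members, it equals one of them. -/
def IsIndepFamily {α : Type*} (J : Set (Set α)) : Prop :=
  ∀ X ∈ J, ∀ n : ℕ, 0 < n → ∀ Xs : Fin n → Set α,
    (∀ i, Xs i ∈ J) → X = ⋃ i, Xs i → ∃ i, X = Xs i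

/-- The Toeplitz condition for `P ⊆ G` (set-theoretic form): for every `g ∈ G` with
`{x ∈ P : gx ∈ P} ≠ ∅` there are `p₁, q₁, …, pₙ, qₙ ∈ P` (`n ≥ 1`) with
`g = p₁⁻¹q₁⋯pₙ⁻¹qₙ` and `{x ∈ P : gx ∈ P} = qₙ⁻¹(pₙ(⋯(q₁⁻¹(p₁P))⋯))`. -/
def IsToeplitz (P : Submonoid G) : Prop :=
  ∀ g : G, {x : G | x ∈ P ∧ g * x ∈ P}.Nonempty →
    ∃ l : List (G × G), l ≠ [] ∧ (∀ pq ∈ l, pq.1 ∈ P ∧ pq.2 ∈ P) ∧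
      g = (l.map fun pq => pq.1⁻¹ * pq.2).prod ∧
      {x : G | x ∈ P ∧ g * x ∈ P} =
        l.foldl (fun S pq => presub P pq.2 (lmul pq.1 S)) (P : Set G)

/-- A `J`-valued filter. -/
def IsFilterOn {α : Type*} (J : Set (Set α)) (F : Set (Set α)) : Prop :=
  F ⊆ J ∧ (∀ X₁ ∈ F, ∀ X₂ ∈ J, X₁ ⊆ X₂ → X₂ ∈ F) ∧
    (∀ X₁ ∈ F, ∀ X₂ ∈ F, X₁ ∩ X₂ ∈ F) ∧ ∅ ∉ F

open Classical in
/-- Indicator function of a family of sets, with values in the discrete space `Bool`;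
this realizes a family as a point of the product space `{0,1}^(Set α)`. -/
noncomputable def chiF {α : Type*} (F : Set (Set α)) : Set α → Bool :=
  fun X => if X ∈ F then true else false

/-- `Σ`, the space of nonempty `𝒥`-valued filters, topologized as a subspace of
`{0,1}^𝒥` via indicator functions. -/
def SigmaT (P : Submonoid G) : Type _ :=
  {F : Set (Set G) // IsFilterOn {X : Set G | IsConstructible P X} F ∧ F.Nonempty}

noncomputable instance (P : Submonoid G) : TopologicalSpace (SigmaT P) :=
  TopologicalSpace.induced (fun F : SigmaT P => chiF F.1) inferInstance

/-- `pℱ = {X ∈ 𝒥 : p⁻¹X ∈ ℱ}`. -/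
def fwdF (P : Submonoid G) (p : G) (F : Set (Set G)) : Set (Set G) :=
  {X : Set G | IsConstructible P X ∧ presub P p X ∈ F}

/-- `p⁻¹𝒢 = {X ∈ 𝒥 : pX ∈ 𝒢}`. -/
def bwdF (P : Submonoid G) (p : G) (F : Set (Set G)) : Set (Set G) :=
  {X : Set G | IsConstructible P X ∧ lmul p X ∈ F}

/-- `ℱ` is a `𝒥`-valued ultrafilter: a maximal element of `Σ` w.r.t. inclusion. -/
def IsUltraFilterOn (P : Submonoid G) (F : Set (Set G)) : Prop :=
  (IsFilterOn {X : Set G | IsConstructible P X} F ∧ F.Nonempty) ∧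
    ∀ F' : Set (Set G), IsFilterOn {X : Set G | IsConstructible P X} F' → F'.Nonempty →
      F ⊆ F' → F' = F

/-- A subset `C ⊆ Σ` is invariant if `pC ⊆ C` and `p⁻¹(C ∩ pΣ) ⊆ C` for all `p ∈ P`. -/
def InvariantOn (P : Submonoid G) (C : Set (SigmaT P)) : Prop :=
  ∀ p ∈ P,
    (∀ F ∈ C, ∀ h : IsFilterOn {X : Set G | IsConstructible P X} (fwdF P p F.1) ∧
        (fwdF P p F.1).Nonempty, (⟨fwdF P p F.1, h⟩ : SigmaT P) ∈ C) ∧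
    (∀ F ∈ C, lmul p (P : Set G) ∈ F.1 →
      ∀ h : IsFilterOn {X : Set G | IsConstructible P X} (bwdF P p F.1) ∧
        (bwdF P p F.1).Nonempty, (⟨bwdF P p F.1, h⟩ : SigmaT P) ∈ C)

namespace IsConstructible

variable {P : Submonoid G} {X : Set G}

theorem subset (hX : IsConstructible P X) : X ⊆ P := by
  induction hX with
  | empty => exact Set.empty_subset _
  | base => exact subset_rfl
  | mul hp _ ih =>
    rintro _ ⟨x, hx, rfl⟩
    exact P.mul_mem hp (ih hx)
  | pre _ _ _ => exact fun y hy => hy.1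

theorem mul_mem (hX : IsConstructible P X) {x y : G} (hx : x ∈ X) (hy : y ∈ P) :
    x * y ∈ X := by
  induction hX generalizing x with
  | empty => exact hx
  | base => exact P.mul_mem hx hy
  | mul _ _ ih =>
    obtain ⟨z, hz, rfl⟩ := hx
    exact ⟨z * y, ih hz, by simp [mul_assoc]⟩
  | pre _ _ ih => exact ⟨P.mul_mem hx.1 hy, by simpa [mul_assoc] using ih hx.2⟩

theorem lmul_subset (hX : IsConstructible P X) {x : G} (hx : x ∈ X) :
    lmul x (P : Set G) ⊆ X := by
  rintro _ ⟨y, hy, rfl⟩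
  exact hX.mul_mem hx hy

end IsConstructible

section Translation

variable {P : Submonoid G} {p : G} {X Y : Set G}

theorem mul_mem_lmul {x : G} : p * x ∈ lmul p X ↔ x ∈ X := by simp [lmul]

theorem lmul_mono (p : G) (h : X ⊆ Y) : lmul p X ⊆ lmul p Y := Set.image_mono h

theorem lmul_inter (p : G) (X Y : Set G) : lmul p (X ∩ Y) = lmul p X ∩ lmul p Y :=
  Set.image_inter (mul_right_injective p)

theorem lmul_empty (p : G) : lmul p ∅ = ∅ := Set.image_empty _

theorem presub_mono (p : G) (h : X ⊆ Y) : presub P p X ⊆ presub P p Y :=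
  fun _ hy => ⟨hy.1, h hy.2⟩

theorem presub_inter (p : G) (X Y : Set G) :
    presub P p (X ∩ Y) = presub P p X ∩ presub P p Y := by
  ext y
  simp only [presub, Set.mem_ofPred_eq, Set.mem_inter_iff]
  tauto

theorem presub_empty (p : G) : presub P p ∅ = ∅ := by simp [presub]

theorem presub_lmul (hX : X ⊆ P) : presub P p (lmul p X) = X := by
  ext y
  simp only [presub, Set.mem_ofPred_eq, mul_mem_lmul]
  exact ⟨And.right, fun h => ⟨hX h, h⟩⟩

theorem lmul_presub : lmul p (presub P p X) = X ∩ lmul p (P : Set G) := by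
  ext y
  constructor
  · rintro ⟨x, hx, rfl⟩
    exact ⟨hx.2, x, hx.1, rfl⟩
  · rintro ⟨hy, x, hx, rfl⟩
    exact ⟨x, ⟨hx, hy⟩, rfl⟩

end Translation

theorem IsConstructible.inter {P : Submonoid G} {X Y : Set G} (hX : IsConstructible P X)
    (hY : IsConstructible P Y) : IsConstructible P (X ∩ Y) := by
  induction hY generalizing X with
  | empty => simpa using IsConstructible.empty
  | base => rwa [Set.inter_eq_left.2 hX.subset]
  | @mul p hp Y hY ih =>
    have h : X ∩ lmul p Y = lmul p (presub P p X ∩ Y) := by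
      rw [lmul_inter, lmul_presub, Set.inter_assoc,
        Set.inter_eq_right.2 (lmul_mono p hY.subset)]
    exact h ▸ (ih (hX.pre hp)).mul hp
  | @pre p hp Y hY ih =>
    have h : X ∩ presub P p Y = presub P p (lmul p X ∩ Y) := by
      rw [presub_inter, presub_lmul hX.subset]
    exact h ▸ (ih (hX.mul hp)).pre hp

/-- A nonempty filter of constructible right ideals, i.e. a family of sets underlying a point
of `SigmaT P`. -/
def IsConstructibleFilter (P : Submonoid G) (F : Set (Set G)) : Prop :=
  IsFilterOn {X : Set G | IsConstructible P X} F ∧ F.Nonempty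

namespace IsConstructibleFilter

variable {P : Submonoid G} {p : G} {F : Set (Set G)} {X Y : Set G}

theorem constructible (hF : IsConstructibleFilter P F) (hX : X ∈ F) : IsConstructible P X :=
  hF.1.1 hX

theorem mem_of_superset (hF : IsConstructibleFilter P F) (hX : X ∈ F)
    (hY : IsConstructible P Y) (h : X ⊆ Y) : Y ∈ F :=
  hF.1.2.1 X hX Y hY h

theorem inter_mem (hF : IsConstructibleFilter P F) (hX : X ∈ F) (hY : Y ∈ F) : X ∩ Y ∈ F :=
  hF.1.2.2.1 X hX Y hY

theorem nonempty_of_mem (hF : IsConstructibleFilter P F) (hX : X ∈ F) : X.Nonempty :=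
  Set.nonempty_iff_ne_empty.2 fun h => hF.1.2.2.2 (h ▸ hX)

theorem coe_mem (hF : IsConstructibleFilter P F) : (P : Set G) ∈ F :=
  let ⟨_, hX⟩ := hF.2
  hF.mem_of_superset hX .base (hF.constructible hX).subset

theorem singleton_coe (P : Submonoid G) : IsConstructibleFilter P {(P : Set G)} := by
  refine ⟨⟨?_, ?_, ?_, ?_⟩, Set.singleton_nonempty _⟩
  · rintro _ rfl
    exact .base
  · rintro _ rfl Y hY h
    exact hY.subset.antisymm h
  · rintro _ rfl _ rfl
    exact Set.inter_self _
  · exact fun h => Set.nonempty_iff_ne_empty.1 ⟨1, P.one_mem⟩ (Set.mem_singleton_iff.1 h).symm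

theorem fwdF (hF : IsConstructibleFilter P F) (hp : p ∈ P) :
    IsConstructibleFilter P (fwdF P p F) := by
  refine ⟨⟨fun X hX => hX.1, ?_, ?_, ?_⟩, lmul p P, .mul hp .base, ?_⟩
  · exact fun X hX Y hY h => ⟨hY, hF.mem_of_superset hX.2 (.pre hp hY) (presub_mono p h)⟩
  · exact fun X hX Y hY =>
      ⟨hX.1.inter hY.1, (presub_inter (P := P) p X Y) ▸ hF.inter_mem hX.2 hY.2⟩
  · exact fun h => (hF.nonempty_of_mem h.2).ne_empty (presub_empty p)
  · exact (presub_lmul (P := P) (p := p) subset_rfl).symm ▸ hF.coe_mem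

theorem bwdF (hF : IsConstructibleFilter P F) (hp : p ∈ P) (h : lmul p (P : Set G) ∈ F) :
    IsConstructibleFilter P (bwdF P p F) := by
  refine ⟨⟨fun X hX => hX.1, ?_, ?_, ?_⟩, P, .base, h⟩
  · exact fun X hX Y hY h => ⟨hY, hF.mem_of_superset hX.2 (.mul hp hY) (lmul_mono p h)⟩
  · exact fun X hX Y hY => ⟨hX.1.inter hY.1, lmul_inter p X Y ▸ hF.inter_mem hX.2 hY.2⟩
  · exact fun h => (hF.nonempty_of_mem h.2).ne_empty (lmul_empty p)

theorem lmul_coe_mem_fwdF (hF : IsConstructibleFilter P F) (hp : p ∈ P) :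
    lmul p (P : Set G) ∈ _root_.fwdF P p F :=
  ⟨.mul hp .base, (presub_lmul (P := P) (p := p) subset_rfl).symm ▸ hF.coe_mem⟩

theorem bwdF_fwdF (hF : IsConstructibleFilter P F) (hp : p ∈ P) :
    _root_.bwdF P p (_root_.fwdF P p F) = F := by
  ext X
  constructor
  · rintro ⟨hX, -, h⟩
    rwa [presub_lmul hX.subset] at h
  · intro h
    have hX := hF.constructible h
    exact ⟨hX, hX.mul hp, (presub_lmul hX.subset).symm ▸ h⟩

theorem fwdF_bwdF (hF : IsConstructibleFilter P F) (hp : p ∈ P)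
    (hpF : lmul p (P : Set G) ∈ F) : _root_.fwdF P p (_root_.bwdF P p F) = F := by
  ext X
  constructor
  · rintro ⟨hX, -, h⟩
    rw [lmul_presub] at h
    exact hF.mem_of_superset h hX Set.inter_subset_left
  · intro h
    have hX := hF.constructible h
    exact ⟨hX, hX.pre hp, lmul_presub (P := P) ▸ hF.inter_mem h hpF⟩

theorem exists_isUltraFilterOn (hF : IsConstructibleFilter P F) :
    ∃ M, IsUltraFilterOn P M ∧ F ⊆ M := by
  obtain ⟨M, hFM, hM⟩ := zorn_subset_nonempty {F | IsConstructibleFilter P F}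
    (fun c hc hchain hne => by
      refine ⟨⋃₀ c, ⟨⟨?_, ?_, ?_, ?_⟩, ?_⟩, fun s hs => Set.subset_sUnion_of_mem hs⟩
      · rintro X ⟨A, hA, hX⟩
        exact (hc hA).constructible hX
      · rintro X ⟨A, hA, hX⟩ Y hY h
        exact ⟨A, hA, (hc hA).mem_of_superset hX hY h⟩
      · rintro X ⟨A, hA, hX⟩ Y ⟨B, hB, hY⟩
        rcases hchain.total hA hB with h | h
        · exact ⟨B, hB, (hc hB).inter_mem (h hX) hY⟩
        · exact ⟨A, hA, (hc hA).inter_mem hX (h hY)⟩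
      · rintro ⟨A, hA, h⟩
        exact (hc hA).1.2.2.2 h
      · obtain ⟨A, hA⟩ := hne
        exact ⟨P, A, hA, (hc hA).coe_mem⟩) F hF
  exact ⟨M, ⟨hM.1, fun F' h₁ h₂ h => (hM.2 ⟨h₁, h₂⟩ h).antisymm h⟩, hFM⟩

end IsConstructibleFilter

namespace IsUltraFilterOn

variable {P : Submonoid G} {p : G} {F : Set (Set G)} {X : Set G}

theorem isConstructibleFilter (hF : IsUltraFilterOn P F) : IsConstructibleFilter P F := hF.1

theorem eq_of_subset (hF : IsUltraFilterOn P F) {F' : Set (Set G)}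
    (hF' : IsConstructibleFilter P F') (h : F ⊆ F') : F' = F :=
  hF.2 F' hF'.1 hF'.2 h

theorem fwdF (hF : IsUltraFilterOn P F) (hp : p ∈ P) : IsUltraFilterOn P (fwdF P p F) := by
  refine ⟨hF.isConstructibleFilter.fwdF hp, fun F' h₁ h₂ h => ?_⟩
  have hF' : IsConstructibleFilter P F' := ⟨h₁, h₂⟩
  have hpF' := h (hF.isConstructibleFilter.lmul_coe_mem_fwdF hp)
  have hsub : F ⊆ bwdF P p F' := by
    rw [← hF.isConstructibleFilter.bwdF_fwdF hp]
    exact fun X hX => ⟨hX.1, h hX.2⟩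
  rw [← hF.eq_of_subset (hF'.bwdF hp hpF') hsub, hF'.fwdF_bwdF hp hpF']

theorem bwdF (hF : IsUltraFilterOn P F) (hp : p ∈ P) (hpF : lmul p (P : Set G) ∈ F) :
    IsUltraFilterOn P (bwdF P p F) := by
  refine ⟨hF.isConstructibleFilter.bwdF hp hpF, fun F' h₁ h₂ h => ?_⟩
  have hF' : IsConstructibleFilter P F' := ⟨h₁, h₂⟩
  have hsub : F ⊆ _root_.fwdF P p F' := by
    rw [← hF.isConstructibleFilter.fwdF_bwdF hp hpF]
    exact fun X hX => ⟨hX.1, h hX.2⟩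
  rw [← hF.eq_of_subset (hF'.fwdF hp) hsub, hF'.bwdF_fwdF hp]

theorem exists_disjoint (hF : IsUltraFilterOn P F) (hX : IsConstructible P X) (hXF : X ∉ F) :
    ∃ Y ∈ F, X ∩ Y = ∅ := by
  have hF₀ := hF.isConstructibleFilter
  by_contra! hne
  have hF' : IsConstructibleFilter P {Z | IsConstructible P Z ∧ ∃ Y ∈ F, X ∩ Y ⊆ Z} := by
    refine ⟨⟨fun Z hZ => hZ.1, ?_, ?_, ?_⟩, P, .base, P, hF₀.coe_mem, Set.inter_subset_right⟩
    · rintro Z ⟨-, Y, hY, h⟩ Z' hZ' hZZ'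
      exact ⟨hZ', Y, hY, h.trans hZZ'⟩
    · rintro Z ⟨hZ, Y, hY, h⟩ Z' ⟨hZ', Y', hY', h'⟩
      exact ⟨hZ.inter hZ', Y ∩ Y', hF₀.inter_mem hY hY',
        fun x hx => ⟨h ⟨hx.1, hx.2.1⟩, h' ⟨hx.1, hx.2.2⟩⟩⟩
    · rintro ⟨-, Y, hY, h⟩
      exact (hne Y hY).ne_empty (Set.subset_empty_iff.1 h)
  have h := hF.eq_of_subset hF' fun Y hY =>
    ⟨hF₀.constructible hY, Y, hY, Set.inter_subset_right⟩
  exact hXF (h ▸ ⟨hX, P, hF₀.coe_mem, Set.inter_subset_left⟩)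

/-- For finitely many sets, membership in an ultrafilter is decided by a single member. -/
theorem exists_mem_forall_finset (hF : IsUltraFilterOn P F) (T : Finset (Set G)) :
    ∃ Y ∈ F, ∀ X ∈ T, IsConstructible P X → (X ∈ F → Y ⊆ X) ∧ (X ∉ F → X ∩ Y = ∅) := by
  classical
  have hF₀ := hF.isConstructibleFilter
  induction T using Finset.induction_on with
  | empty => exact ⟨P, hF₀.coe_mem, by simp⟩
  | insert X T _ ih =>
    obtain ⟨Y, hY, h⟩ := ih
    obtain ⟨Z, hZ, hXZ⟩ : ∃ Z ∈ F,
        IsConstructible P X → (X ∈ F → Z ⊆ X) ∧ (X ∉ F → X ∩ Z = ∅) := by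
      by_cases hXF : X ∈ F
      · exact ⟨X, hXF, fun _ => ⟨fun _ => subset_rfl, fun h => absurd hXF h⟩⟩
      by_cases hX : IsConstructible P X
      · obtain ⟨Z, hZ, hXZ⟩ := hF.exists_disjoint hX hXF
        exact ⟨Z, hZ, fun _ => ⟨fun h => absurd h hXF, fun _ => hXZ⟩⟩
      · exact ⟨P, hF₀.coe_mem, fun h => absurd h hX⟩
    have mono {A B W : Set G} (hAB : A ⊆ B) (hW : (W ∈ F → B ⊆ W) ∧ (W ∉ F → W ∩ B = ∅)) :
        (W ∈ F → A ⊆ W) ∧ (W ∉ F → W ∩ A = ∅) :=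
      ⟨fun h => hAB.trans (hW.1 h), fun h =>
        Set.subset_empty_iff.1 (hW.2 h ▸ Set.inter_subset_inter_right W hAB)⟩
    refine ⟨Y ∩ Z, hF₀.inter_mem hY hZ, fun W hW hWc => ?_⟩
    rcases Finset.mem_insert.1 hW with rfl | hW
    · exact mono Set.inter_subset_right (hXZ hWc)
    · exact mono Set.inter_subset_left (h W hW hWc)

end IsUltraFilterOn

theorem chiF_eq_chiF_iff {α : Type*} {F F' : Set (Set α)} {X : Set α} :
    chiF F X = chiF F' X ↔ (X ∈ F ↔ X ∈ F') := by
  by_cases h : X ∈ F <;> by_cases h' : X ∈ F' <;> simp [chiF, h, h']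

namespace SigmaT

variable {P : Submonoid G}

theorem isConstructibleFilter (F : SigmaT P) : IsConstructibleFilter P F.1 := F.2

theorem mem_closure_iff_finset {S : Set (SigmaT P)} {F : SigmaT P} :
    F ∈ closure S ↔ ∀ T : Finset (Set G), ∃ F' ∈ S, ∀ X ∈ T, X ∈ F'.1 ↔ X ∈ F.1 := by
  rw [mem_closure_iff]
  constructor
  · intro h T
    have hopen : IsOpen {F' : SigmaT P | ∀ X ∈ T, X ∈ F'.1 ↔ X ∈ F.1} := by
      refine ⟨(T : Set (Set G)).pi fun X => {chiF F.1 X},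
        isOpen_set_pi T.finite_toSet fun _ _ => isOpen_discrete _, ?_⟩
      ext F'
      simp [Set.mem_pi, chiF_eq_chiF_iff]
    obtain ⟨F', hF', hS⟩ := h _ hopen fun _ _ => Iff.rfl
    exact ⟨F', hS, hF'⟩
  · rintro h _ ⟨V, hV, rfl⟩ hF
    obtain ⟨T, u, hu, hsub⟩ := isOpen_pi_iff.1 hV _ hF
    obtain ⟨F', hS, hF'⟩ := h T
    refine ⟨F', hsub fun X hX => ?_, hS⟩
    change chiF F'.1 X ∈ u X
    rw [chiF_eq_chiF_iff.2 (hF' X hX)]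
    exact (hu X hX).2

theorem invariantOn_closure_isUltraFilterOn (P : Submonoid G) :
    InvariantOn P (closure {F : SigmaT P | IsUltraFilterOn P F.1}) := by
  classical
  refine fun p hp => ⟨fun F hF _ => ?_, fun F hF hpF _ => ?_⟩ <;>
    refine mem_closure_iff_finset.2 fun T => ?_
  · obtain ⟨M, hM, h⟩ := mem_closure_iff_finset.1 hF (T.image (presub P p))
    exact ⟨⟨_, M.isConstructibleFilter.fwdF hp⟩, hM.fwdF hp, fun X hX =>
      and_congr_right fun _ => h _ (Finset.mem_image_of_mem _ hX)⟩
  · obtain ⟨M, hM, h⟩ :=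
      mem_closure_iff_finset.1 hF (insert (lmul p P) (T.image (lmul p)))
    have hpM := (h _ (Finset.mem_insert_self _ _)).2 hpF
    exact ⟨⟨_, M.isConstructibleFilter.bwdF hp hpM⟩, hM.bwdF hp hpM, fun X hX =>
      and_congr_right fun _ => h _ (Finset.mem_insert_of_mem (Finset.mem_image_of_mem _ hX))⟩

theorem isUltraFilterOn_mem_of_invariantOn {C : Set (SigmaT P)} (hne : C.Nonempty)
    (hC : IsClosed C) (hinv : InvariantOn P C) {F : SigmaT P} (hF : IsUltraFilterOn P F.1) :
    F ∈ C := by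
  rw [← hC.closure_eq, mem_closure_iff_finset]
  intro T
  obtain ⟨A, hA⟩ := hne
  obtain ⟨Y, hY, h⟩ := hF.exists_mem_forall_finset T
  have hYc := F.isConstructibleFilter.constructible hY
  obtain ⟨x, hx⟩ := F.isConstructibleFilter.nonempty_of_mem hY
  have hxP : x ∈ P := hYc.subset hx
  have hxA := A.isConstructibleFilter.fwdF hxP
  have hYxA : Y ∈ fwdF P x A.1 := hxA.mem_of_superset
    (A.isConstructibleFilter.lmul_coe_mem_fwdF hxP) hYc (hYc.lmul_subset hx)
  refine ⟨⟨_, hxA⟩, (hinv x hxP).1 A hA hxA, fun X hX => ⟨fun hXA => ?_, fun hXF => ?_⟩⟩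
  · by_contra hXF
    exact (hxA.nonempty_of_mem (hxA.inter_mem hXA hYxA)).ne_empty
      ((h X hX (hxA.constructible hXA)).2 hXF)
  · have hXc := F.isConstructibleFilter.constructible hXF
    exact hxA.mem_of_superset hYxA hXc ((h X hX hXc).1 hXF)

end SigmaT

/-- `∂Σ` (the closure of `Σ_max` in `Σ`) is the minimal nonempty closed invariant
subset of `Σ`. -/
theorem stmt_11 (P : Submonoid G) :
    (closure {F : SigmaT P | IsUltraFilterOn P F.1}).Nonempty ∧
      IsClosed (closure {F : SigmaT P | IsUltraFilterOn P F.1}) ∧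
      InvariantOn P (closure {F : SigmaT P | IsUltraFilterOn P F.1}) ∧
      ∀ C : Set (SigmaT P), C.Nonempty → IsClosed C → InvariantOn P C →
        closure {F : SigmaT P | IsUltraFilterOn P F.1} ⊆ C := by
  refine ⟨?_, isClosed_closure, SigmaT.invariantOn_closure_isUltraFilterOn P,
    fun C hne hC hinv => closure_minimal
      (fun F hF => SigmaT.isUltraFilterOn_mem_of_invariantOn hne hC hinv hF) hC⟩
  obtain ⟨M, hM, -⟩ := (IsConstructibleFilter.singleton_coe P).exists_isUltraFilterOn
  exact ⟨⟨M, hM.1⟩, subset_closure hM⟩
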